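/- Let φ be a 3-form on ℝ⁶ with ω ∧ φ = 0 and φ(Jx, Jy, z) = −φ(x, y, z) for all x, y, z (J the standard complex structure), and let α be a 1-form on ℝ⁶. Define the 3-form ψ := (α∘J) ∧ ω, where (α∘J)(x) := α(Jx). Then ψ⊠φ = 2·α∧φ as 4-forms on ℝ⁶. -/

import Mathlib

noncomputable section

/-- The underlying vector space `ℝ⁶`. -/
abbrev V6 : Type := Fin 6 → ℝ

/-- The standard basis of `ℝ⁶`. -/
def e6 (i : Fin 6) : V6 := fun j => if j = i then (1 : ℝ) else 0

/-- The standard complex structure `J` with `Je₁=e₂, Je₂=−e₁, Je₃=e₄, Je₄=−e₃, Je₅=e₆,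
Je₆=−e₅`. -/
def Jstd (x : V6) : V6 := ![-x 1, x 0, -x 3, x 2, -x 5, x 4]

/-- For a trilinear map `T` antisymmetric in its last two arguments and a 3-form `μ`,
the quadrilinear map `T ⊠ μ` (indices raised with the standard Euclidean metric). -/
def boxt (T μ : V6 → V6 → V6 → ℝ) (x y z w : V6) : ℝ :=
  ∑ p : Fin 6,
    (T (e6 p) x y * μ (e6 p) z w + T (e6 p) z w * μ (e6 p) x y
      - T (e6 p) x z * μ (e6 p) y w - T (e6 p) y w * μ (e6 p) x z
      + T (e6 p) x w * μ (e6 p) y z + T (e6 p) y z * μ (e6 p) x w)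

/-- A 3-form, viewed as a trilinear function of vectors. -/
def ap3 (φ : AlternatingMap ℝ V6 ℝ (Fin 3)) : V6 → V6 → V6 → ℝ :=
  fun x y z => φ ![x, y, z]

/-- The standard symplectic form `ω = e¹∧e² + e³∧e⁴ + e⁵∧e⁶`. -/
def ω6 (x y : V6) : ℝ :=
  x 0 * y 1 - x 1 * y 0 + x 2 * y 3 - x 3 * y 2 + x 4 * y 5 - x 5 * y 4

/-- Wedge product of a 2-form and a 3-form (standard convention `1/(2!·3!)`). -/
def wedge23 (a : V6 → V6 → ℝ) (b : V6 → V6 → V6 → ℝ) (v : Fin 5 → V6) : ℝ :=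
  (1 / 12 : ℝ) * ∑ σ : Equiv.Perm (Fin 5),
    ((Equiv.Perm.sign σ : ℤ) : ℝ) *
      (a (v (σ 0)) (v (σ 1)) * b (v (σ 2)) (v (σ 3)) (v (σ 4)))

theorem ap3_swap_left (φ : AlternatingMap ℝ V6 ℝ (Fin 3)) (x y z : V6) :
    ap3 φ y x z = -ap3 φ x y z := by
  have h := φ.map_swap ![x, y, z] (i := 0) (j := 1) (by decide)
  have e : ![x, y, z] ∘ Equiv.swap (0 : Fin 3) 1 = ![y, x, z] := by
    funext i; fin_cases i <;> rfl
  rwa [e] at h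

theorem ap3_swap_right (φ : AlternatingMap ℝ V6 ℝ (Fin 3)) (x y z : V6) :
    ap3 φ x z y = -ap3 φ x y z := by
  have h := φ.map_swap ![x, y, z] (i := 1) (j := 2) (by decide)
  have e : ![x, y, z] ∘ Equiv.swap (1 : Fin 3) 2 = ![x, z, y] := by
    funext i; fin_cases i <;> rfl
  rwa [e] at h

theorem sum_sign_perm_five (A : Fin 5 → Fin 5 → ℝ) (B : Fin 5 → Fin 5 → Fin 5 → ℝ)
    (hA : ∀ i j, A j i = -A i j) (hl : ∀ i j k, B j i k = -B i j k)
    (hr : ∀ i j k, B i k j = -B i j k) :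
    ∑ σ : Equiv.Perm (Fin 5),
      ((Equiv.Perm.sign σ : ℤ) : ℝ) * (A (σ 0) (σ 1) * B (σ 2) (σ 3) (σ 4))
      = 12 * (A 0 1 * B 2 3 4 - A 0 2 * B 1 3 4 + A 0 3 * B 1 2 4 - A 0 4 * B 1 2 3
        + A 1 2 * B 0 3 4 - A 1 3 * B 0 2 4 + A 1 4 * B 0 2 3
        + A 2 3 * B 0 1 4 - A 2 4 * B 0 1 3 + A 3 4 * B 0 1 2) := by
  have hA' : ∀ i j, i < j → A j i = -A i j := fun i j _ => hA i j
  have hl' : ∀ i j k, i < j → B j i k = -B i j k := fun i j k _ => hl i j k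
  have hr' : ∀ i j k, j < k → B i k j = -B i j k := fun i j k _ => hr i j k
  have h1 : (1 : Fin 5) = Fin.succ 0 := rfl
  have h2 : (2 : Fin 5) = Fin.succ (Fin.succ 0) := rfl
  have h3 : (3 : Fin 5) = Fin.succ (Fin.succ (Fin.succ 0)) := rfl
  have h4 : (4 : Fin 5) = Fin.succ (Fin.succ (Fin.succ (Fin.succ 0))) := rfl
  have expand : ∀ (n : ℕ) (f : Equiv.Perm (Fin (n + 1)) → ℝ),
      ∑ σ, f σ = ∑ p, ∑ τ, f (Equiv.Perm.decomposeFin.symm (p, τ)) := fun n f => by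
    rw [← Fintype.sum_prod_type', Equiv.sum_comp Equiv.Perm.decomposeFin.symm]
  conv_lhs =>
    simp only [h1, h2, h3, h4, expand, Equiv.Perm.decomposeFin_symm_apply_succ,
      Equiv.Perm.decomposeFin_symm_apply_zero, Equiv.Perm.decomposeFin.symm_sign]
  simp only [Finset.univ_unique, Finset.sum_singleton, Fin.sum_univ_succ]
  simp [Equiv.swap_apply_def]
  simp only [hA', hl', hr', Fin.reduceLT]
  ring

theorem ap3_eq_sum (φ : AlternatingMap ℝ V6 ℝ (Fin 3)) (c y z : V6) :
    ∑ p, c p * ap3 φ (e6 p) y z = ap3 φ c y z := by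
  have hc : c = ∑ p, c p • e6 p := by
    ext j; simp [e6]
  have hup : ∀ x : V6, ap3 φ x y z =
      φ.toMultilinearMap.toLinearMap ![0, y, z] 0 x := fun x => by
    change φ _ = φ _
    congr 1
    funext i
    fin_cases i <;> rfl
  conv_rhs => rw [hc]
  simp only [hup, map_sum, map_smul, smul_eq_mul]

theorem linear_eq_sum (α : V6 →ₗ[ℝ] ℝ) (x : V6) : α x = ∑ p, x p * α (e6 p) := by
  have hx : x = ∑ p, x p • e6 p := by
    ext j; simp [e6]
  conv_lhs => rw [hx]
  simp only [map_sum, map_smul, smul_eq_mul]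

theorem ω6_e6_left (p : Fin 6) (y : V6) : ω6 (e6 p) y = -Jstd y p := by
  fin_cases p <;> simp [ω6, e6, Jstd]

theorem ω6_swap (x y : V6) : ω6 y x = -ω6 x y := by
  simp only [ω6]; ring

theorem ω6_Jstd (x y : V6) : ω6 (Jstd x) (Jstd y) = ω6 x y := by
  simp [ω6, Jstd]; ring

theorem ω6_dual (α : V6 →ₗ[ℝ] ℝ) (x : V6) : ω6 (fun p => α (Jstd (e6 p))) x = α x := by
  simp only [ω6, linear_eq_sum α x, linear_eq_sum α (Jstd _), Fin.sum_univ_six]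
  simp [Jstd, e6]; ring

theorem wedge23_ω6_ap3 (φ : AlternatingMap ℝ V6 ℝ (Fin 3)) (v x y z w : V6) :
    wedge23 ω6 (ap3 φ) ![v, x, y, z, w] =
      ω6 v x * ap3 φ y z w - ω6 v y * ap3 φ x z w + ω6 v z * ap3 φ x y w - ω6 v w * ap3 φ x y z
        + ω6 x y * ap3 φ v z w - ω6 x z * ap3 φ v y w + ω6 x w * ap3 φ v y z
        + ω6 y z * ap3 φ v x w - ω6 y w * ap3 φ v x z + ω6 z w * ap3 φ v x y := by
  rw [wedge23, sum_sign_perm_five (fun i j => ω6 (![v, x, y, z, w] i) (![v, x, y, z, w] j))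
    (fun i j k => ap3 φ (![v, x, y, z, w] i) (![v, x, y, z, w] j) (![v, x, y, z, w] k))
    (fun _ _ => ω6_swap _ _) (fun _ _ _ => ap3_swap_left φ _ _ _)
    (fun _ _ _ => ap3_swap_right φ _ _ _)]
  simp only [Matrix.cons_val]
  ring

/-- The contraction of `(α ∘ J) ∧ ω` with a 3-form in their first arguments. -/
theorem sum_wedge_ω6_mul_ap3 (φ : AlternatingMap ℝ V6 ℝ (Fin 3)) (α : V6 →ₗ[ℝ] ℝ) (x y z w : V6) :
    ∑ p, (α (Jstd (e6 p)) * ω6 x y - α (Jstd x) * ω6 (e6 p) y + α (Jstd y) * ω6 (e6 p) x)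
        * ap3 φ (e6 p) z w
      = ω6 x y * ap3 φ (fun p => α (Jstd (e6 p))) z w
        + α (Jstd x) * ap3 φ (Jstd y) z w - α (Jstd y) * ap3 φ (Jstd x) z w := by
  rw [← ap3_eq_sum φ (fun p => α (Jstd (e6 p))), ← ap3_eq_sum φ (Jstd y),
    ← ap3_eq_sum φ (Jstd x)]
  simp only [ω6_e6_left, Finset.mul_sum, ← Finset.sum_add_distrib,
    ← Finset.sum_sub_distrib]
  exact Finset.sum_congr rfl fun p _ => by ring

/-- Let φ be a 3-form with `ω ∧ φ = 0` and `φ(Jx,Jy,z) = −φ(x,y,z)`, and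
let α be a 1-form.  For `ψ := (α∘J) ∧ ω` one has `ψ ⊠ φ = 2·α∧φ` as 4-forms. -/
theorem U_boxtimes_phi (φ : AlternatingMap ℝ V6 ℝ (Fin 3))
    (hprim : ∀ v : Fin 5 → V6, wedge23 ω6 (ap3 φ) v = 0)
    (hφ : ∀ x y z : V6, φ ![Jstd x, Jstd y, z] = -φ ![x, y, z])
    (α : V6 →ₗ[ℝ] ℝ) :
    ∀ x y z w : V6,
      boxt (fun a b c => α (Jstd a) * ω6 b c - α (Jstd b) * ω6 a c + α (Jstd c) * ω6 a b)
        (ap3 φ) x y z w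
      = 2 * (α x * φ ![y, z, w] - α y * φ ![x, z, w]
          + α z * φ ![x, y, w] - α w * φ ![x, y, z]) := by
  intro x y z w
  set v : V6 := fun p => α (Jstd (e6 p)) with hv
  have hJ : ∀ x, Jstd (Jstd x) = -x := fun x => by
    ext i; fin_cases i <;> simp [Jstd]
  have hJ₁₂ : ∀ a b c, ap3 φ (Jstd a) (Jstd b) c = -ap3 φ a b c := hφ
  have hJ₂₃ : ∀ a b c, ap3 φ a (Jstd b) (Jstd c) = -ap3 φ a b c := fun a b c => by
    linarith [hJ₁₂ b c a, ap3_swap_left φ a (Jstd b) (Jstd c), ap3_swap_right φ (Jstd b) a (Jstd c),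
      ap3_swap_left φ a b c, ap3_swap_right φ b a c]
  have hneg : ∀ a b c, ap3 φ (-a) b c = -ap3 φ a b c := fun a b c => by
    rw [← ap3_eq_sum φ (-a), ← ap3_eq_sum φ a]
    simp
  have hJ_move : ∀ a b c, ap3 φ a (Jstd b) c = ap3 φ (Jstd a) b c := fun a b c => by
    have h := hJ₁₂ (Jstd a) b c
    rw [hJ, hneg] at h
    linarith
  have hJ_swap : ∀ a b c, ap3 φ (Jstd b) a c = -ap3 φ (Jstd a) b c := fun a b c => by
    rw [ap3_swap_left, hJ_move]
  have hω : ∀ a, ω6 v a = α a := ω6_dual α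
  have hwedge := (wedge23_ω6_ap3 φ v x y z w).symm.trans (hprim _)
  have hwedgeJ :=
    (wedge23_ω6_ap3 φ v (Jstd x) (Jstd y) (Jstd z) (Jstd w)).symm.trans (hprim _)
  simp only [hω] at hwedge
  simp only [hω, ω6_Jstd, hJ₂₃] at hwedgeJ
  have hcontr := sum_wedge_ω6_mul_ap3 φ α
  simp only [boxt, Finset.sum_add_distrib, Finset.sum_sub_distrib, hcontr]
  change _ = 2 * (α x * ap3 φ y z w - α y * ap3 φ x z w + α z * ap3 φ x y w - α w * ap3 φ x y z)
  rw [← hv]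
  have c := fun a b d => ap3_swap_right φ (Jstd a) b d
  rw [hJ_swap x w y, c x y w, hJ_swap x z y, c x y z, hJ_swap y z w, hJ_swap x w z, c x z w,
    hJ_swap x y z, hJ_swap y w z, c y z w, hJ_swap x z w, hJ_swap x y w]
  linear_combination -2 * hwedge - 3 * hwedgeJ
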